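/- The four holomorphic functions E₄(τ), E₆(τ), φ_{0,1}(τ,z), φ_{−2,1}(τ,z) on ℍ×ℂ are algebraically independent over ℂ: there is no nonzero polynomial P ∈ ℂ[X₁,X₂,X₃,X₄] with P(E₄(τ), E₆(τ), φ_{0,1}(τ,z), φ_{−2,1}(τ,z)) = 0 for all (τ,z) ∈ ℍ×ℂ. -/

import Mathlib

noncomputable section

open Complex

namespace JacobiPaper

/-- `e2 w = e^{2 π i w}`. -/
def e2 (w : ℂ) : ℂ := Complex.exp (2 * (Real.pi : ℂ) * Complex.I * w)

/-- `q = e^{2 π i τ}`. -/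
def qC (τ : ℂ) : ℂ := e2 τ

/-- `ζ = e^{2 π i z}`. -/
def zetaC (z : ℂ) : ℂ := e2 z

/-- The Dedekind eta function `η(τ) = q^{1/24} ∏_{n ≥ 1} (1 - qⁿ)`. -/
def eta (τ : ℂ) : ℂ :=
  Complex.exp ((Real.pi : ℂ) * Complex.I * τ / 12) * ∏' n : ℕ, (1 - qC τ ^ (n + 1))

/-- The odd Jacobi theta function
`ϑ(τ,z) = q^{1/8} (ζ^{1/2} - ζ^{-1/2}) ∏_{n ≥ 1} (1 - qⁿζ)(1 - qⁿζ⁻¹)(1 - qⁿ)`. -/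
def theta (τ z : ℂ) : ℂ :=
  Complex.exp ((Real.pi : ℂ) * Complex.I * τ / 4) *
    (Complex.exp ((Real.pi : ℂ) * Complex.I * z) - Complex.exp (-((Real.pi : ℂ) * Complex.I * z))) *
    ∏' n : ℕ,
      ((1 - qC τ ^ (n + 1) * zetaC z) * (1 - qC τ ^ (n + 1) * (zetaC z)⁻¹) * (1 - qC τ ^ (n + 1)))

/-- `ϑ₀₀(τ,z) = Σ_{n ∈ ℤ} q^{n²/2} ζⁿ`. -/
def theta00 (τ z : ℂ) : ℂ :=
  ∑' n : ℤ, Complex.exp ((Real.pi : ℂ) * Complex.I * (n : ℂ) ^ 2 * τ +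
    2 * (Real.pi : ℂ) * Complex.I * (n : ℂ) * z)

/-- `ϑ₀₁(τ,z) = Σ_{n ∈ ℤ} (-1)ⁿ q^{n²/2} ζⁿ`. -/
def theta01 (τ z : ℂ) : ℂ :=
  ∑' n : ℤ, (-1 : ℂ) ^ n * Complex.exp ((Real.pi : ℂ) * Complex.I * (n : ℂ) ^ 2 * τ +
    2 * (Real.pi : ℂ) * Complex.I * (n : ℂ) * z)

/-- `ϑ₁₀(τ,z) = q^{1/8} ζ^{1/2} Σ_{n ∈ ℤ} q^{n(n+1)/2} ζⁿ`. -/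
def theta10 (τ z : ℂ) : ℂ :=
  Complex.exp ((Real.pi : ℂ) * Complex.I * τ / 4) * Complex.exp ((Real.pi : ℂ) * Complex.I * z) *
    ∑' n : ℤ, Complex.exp ((Real.pi : ℂ) * Complex.I * (n : ℂ) * ((n : ℂ) + 1) * τ +
      2 * (Real.pi : ℂ) * Complex.I * (n : ℂ) * z)

/-- `ξ₀₀(τ,z) = ϑ₀₀(τ,z)/ϑ₀₀(τ,0)`. -/
def xi00 (τ z : ℂ) : ℂ := theta00 τ z / theta00 τ 0

/-- `ξ₀₁(τ,z) = ϑ₀₁(τ,z)/ϑ₀₁(τ,0)`. -/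
def xi01 (τ z : ℂ) : ℂ := theta01 τ z / theta01 τ 0

/-- `ξ₁₀(τ,z) = ϑ₁₀(τ,z)/ϑ₁₀(τ,0)`. -/
def xi10 (τ z : ℂ) : ℂ := theta10 τ z / theta10 τ 0

/-- The weak Jacobi form `φ_{0,1} = 4(ξ₀₀² + ξ₀₁² + ξ₁₀²)`. -/
def phi01 (τ z : ℂ) : ℂ := 4 * (xi00 τ z ^ 2 + xi01 τ z ^ 2 + xi10 τ z ^ 2)

/-- The weak Jacobi form `φ_{0,2}(τ,z) = 2(ξ₀₀ + ξ₀₁ + ξ₁₀)(τ,2z)`. -/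
def phi02 (τ z : ℂ) : ℂ := 2 * (xi00 τ (2 * z) + xi01 τ (2 * z) + xi10 τ (2 * z))

/-- The weak Jacobi form `φ_{0,3}(τ,z) = ϑ(τ,2z)²/ϑ(τ,z)²`. -/
def phi03 (τ z : ℂ) : ℂ := theta τ (2 * z) ^ 2 / theta τ z ^ 2

/-- The weak Jacobi form `φ_{0,4}(τ,z) = ϑ(τ,3z)/ϑ(τ,z)`. -/
def phi04 (τ z : ℂ) : ℂ := theta τ (3 * z) / theta τ z

/-- The weak Jacobi form `φ_{-2,1}(τ,z) = ϑ(τ,z)²/η(τ)⁶`. -/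
def phiM21 (τ z : ℂ) : ℂ := theta τ z ^ 2 / eta τ ^ 6

/-- The divisor power sum `σ_k(n)`. -/
def sigma' (k n : ℕ) : ℕ := ∑ d ∈ n.divisors, d ^ k

/-- The normalized Eisenstein series `E_k(τ) = 1 - (2k/B_k) Σ_{n ≥ 1} σ_{k-1}(n) qⁿ`. -/
def Eis (k : ℕ) (τ : ℂ) : ℂ :=
  1 - (2 * (k : ℂ) / ((bernoulli k : ℚ) : ℂ)) *
    ∑' n : ℕ, (sigma' (k - 1) (n + 1) : ℂ) * qC τ ^ (n + 1)

/-- The discriminant cusp form `Δ = η²⁴`. -/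
def Delta (τ : ℂ) : ℂ := eta τ ^ 24

/-- The modular invariant `j = E₄³/Δ`. -/
def jInv (τ : ℂ) : ℂ := Eis 4 τ ^ 3 / Delta τ

/-- A choice of `(a, b)` with `a d - b c = 1` completing a coprime pair `(c, d)` to a matrix
`(a b; c d) ∈ SL₂(ℤ)`. -/
def bezout (c d : ℤ) : ℤ × ℤ :=
  haveI : Decidable (∃ ab : ℤ × ℤ, ab.1 * d - ab.2 * c = 1) := Classical.propDecidable _
  if h : ∃ ab : ℤ × ℤ, ab.1 * d - ab.2 * c = 1 then h.choose else 0

/-- The summand `(cτ+d)^{-k} Σ_{l ∈ ℤ} e^{2πim(l²(aτ+b)/(cτ+d) + 2lz/(cτ+d) - cz²/(cτ+d))}`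
of the Jacobi–Eisenstein series attached to a coprime pair `(c,d)`; it does not depend on the
choice of `(a,b)` completing `(c,d)` to an element of `SL₂(ℤ)`. -/
def EisJSummand (k m : ℕ) (τ z : ℂ) (c d : ℤ) : ℂ :=
  ((c : ℂ) * τ + (d : ℂ)) ^ (-(k : ℤ)) *
    ∑' l : ℤ, e2 ((m : ℂ) * ((l : ℂ) ^ 2 * (((bezout c d).1 : ℂ) * τ + ((bezout c d).2 : ℂ)) /
        ((c : ℂ) * τ + (d : ℂ)) +
      2 * (l : ℂ) * z / ((c : ℂ) * τ + (d : ℂ)) - (c : ℂ) * z ^ 2 / ((c : ℂ) * τ + (d : ℂ))))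

/-- The Jacobi–Eisenstein series `E_{k,m}` of weight `k` and index `m`. -/
def EisJ (k m : ℕ) (τ z : ℂ) : ℂ :=
  (1 / 2) * ∑' p : {p : ℤ × ℤ // IsCoprime p.1 p.2}, EisJSummand k m τ z p.1.1 p.1.2

/-- `F_{6,3} = (1/2)(E_{6,1} φ_{0,2} - E₆ φ_{0,3})`. -/
def F63 (τ z : ℂ) : ℂ := (1 / 2) * (EisJ 6 1 τ z * phi02 τ z - Eis 6 τ * phi03 τ z)

/-- A weak Jacobi form of weight `k ∈ ℤ` and index `m ∈ ℕ`: a holomorphic function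
`φ : ℍ × ℂ → ℂ` satisfying the two Jacobi transformation laws and having a Fourier expansion
`φ(τ,z) = Σ_{n ≥ 0, l ∈ ℤ} f(n,l) qⁿ ζˡ`. -/
def IsWeakJacobiForm (k : ℤ) (m : ℕ) (φ : ℂ → ℂ → ℂ) (f : ℕ → ℤ → ℂ) : Prop :=
  DifferentiableOn ℂ (fun p : ℂ × ℂ => φ p.1 p.2) {p : ℂ × ℂ | 0 < p.1.im} ∧
  (∀ a b c d : ℤ, a * d - b * c = 1 → ∀ τ z : ℂ, 0 < τ.im →
    φ (((a : ℂ) * τ + (b : ℂ)) / ((c : ℂ) * τ + (d : ℂ))) (z / ((c : ℂ) * τ + (d : ℂ))) =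
      ((c : ℂ) * τ + (d : ℂ)) ^ k *
        e2 ((m : ℂ) * ((c : ℂ) * z ^ 2 / ((c : ℂ) * τ + (d : ℂ)))) * φ τ z) ∧
  (∀ x y : ℤ, ∀ τ z : ℂ, 0 < τ.im →
    φ τ (z + (x : ℂ) * τ + (y : ℂ)) =
      e2 (-(m : ℂ) * ((x : ℂ) ^ 2 * τ + 2 * (x : ℂ) * z)) * φ τ z) ∧
  (∀ τ z : ℂ, 0 < τ.im →
    HasSum (fun p : ℕ × ℤ => f p.1 p.2 * e2 ((p.1 : ℂ) * τ + (p.2 : ℂ) * z)) (φ τ z))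

/-- A weakly holomorphic Jacobi form of weight `0` and index `m ∈ ℕ`: as a weak Jacobi form,
but the Fourier expansion `φ(τ,z) = Σ_{n ≥ n₀, l ∈ ℤ} f(n,l) qⁿ ζˡ` may contain finitely many
negative powers of `q`. -/
def IsWeaklyHolomorphicJacobiForm0 (m : ℕ) (φ : ℂ → ℂ → ℂ) (f : ℤ → ℤ → ℂ) : Prop :=
  DifferentiableOn ℂ (fun p : ℂ × ℂ => φ p.1 p.2) {p : ℂ × ℂ | 0 < p.1.im} ∧
  (∀ a b c d : ℤ, a * d - b * c = 1 → ∀ τ z : ℂ, 0 < τ.im →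
    φ (((a : ℂ) * τ + (b : ℂ)) / ((c : ℂ) * τ + (d : ℂ))) (z / ((c : ℂ) * τ + (d : ℂ))) =
      e2 ((m : ℂ) * ((c : ℂ) * z ^ 2 / ((c : ℂ) * τ + (d : ℂ)))) * φ τ z) ∧
  (∀ x y : ℤ, ∀ τ z : ℂ, 0 < τ.im →
    φ τ (z + (x : ℂ) * τ + (y : ℂ)) =
      e2 (-(m : ℂ) * ((x : ℂ) ^ 2 * τ + 2 * (x : ℂ) * z)) * φ τ z) ∧
  (∃ n₀ : ℤ, ∀ n : ℤ, n < n₀ → ∀ l : ℤ, f n l = 0) ∧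
  (∀ τ z : ℂ, 0 < τ.im →
    HasSum (fun p : ℤ × ℤ => f p.1 p.2 * e2 ((p.1 : ℂ) * τ + (p.2 : ℂ) * z)) (φ τ z))

/-- A function `φ` on `ℍ × ℂ` has integral Fourier coefficients if it is the sum of a Fourier
series `Σ_{n ≥ 0, l ∈ ℤ} f(n,l) qⁿ ζˡ` with all `f(n,l) ∈ ℤ`. -/
def HasIntegralFourierExpansion (φ : ℂ → ℂ → ℂ) : Prop :=
  ∃ f : ℕ → ℤ → ℤ, ∀ τ z : ℂ, 0 < τ.im →
    HasSum (fun p : ℕ × ℤ => (f p.1 p.2 : ℂ) * e2 ((p.1 : ℂ) * τ + (p.2 : ℂ) * z)) (φ τ z)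

/-- Applying an algebra homomorphism to `ℂ` commutes with evaluating a polynomial. -/
lemma algHom_aeval_eq_eval {σ A : Type*} [CommRing A] [Algebra ℂ A] (φ : A →ₐ[ℂ] ℂ) (g : σ → A)
    (Q : MvPolynomial σ ℂ) :
    φ (MvPolynomial.aeval g Q) = MvPolynomial.eval (fun i ↦ φ (g i)) Q := by
  rw [MvPolynomial.comp_aeval_apply, MvPolynomial.aeval_eq_eval]

section BivariatePolynomials

open Polynomial

lemma differentiable_evalEval {f g : ℂ → ℂ} (hf : Differentiable ℂ f) (hg : Differentiable ℂ g)
    (p : Polynomial (Polynomial ℂ)) : Differentiable ℂ fun z ↦ p.evalEval (f z) (g z) := by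
  induction p using Polynomial.induction_on' with
  | add p q hp hq =>
    simp only [evalEval_add]
    exact hp.add hq
  | monomial n a =>
    have h : (fun z ↦ (monomial n a).evalEval (f z) (g z)) = fun z ↦ a.eval (f z) * g z ^ n := by
      ext z
      simp [evalEval, eval_monomial]
    rw [h]
    exact (a.differentiable.comp hf).mul (hg.pow n)

/-- Two entire functions are algebraically independent if the second one is not identically zero
and the first one takes infinitely many values on the zero set of the second one. -/
lemma eq_zero_of_evalEval_eq_zero {f g : ℂ → ℂ} (hf : Differentiable ℂ f)
    (hg : Differentiable ℂ g) (hg0 : ∃ z, g z ≠ 0) {w : ℕ → ℂ} (hw : ∀ m, g (w m) = 0)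
    (hinj : Function.Injective fun m ↦ f (w m)) {p : Polynomial (Polynomial ℂ)}
    (hp : ∀ z, p.evalEval (f z) (g z) = 0) : p = 0 := by
  have key : ∀ (p : Polynomial (Polynomial ℂ)), (∀ z, p.evalEval (f z) (g z) = 0) →
      p.coeff 0 = 0 := by
    intro p hp
    refine Polynomial.eq_zero_of_infinite_isRoot _
      ((Set.infinite_range_of_injective hinj).mono ?_)
    rintro _ ⟨m, rfl⟩
    have h := hp (w m)
    rw [← p.divX_mul_X_add, evalEval_add, evalEval_mul, evalEval_X, evalEval_C, hw, mul_zero,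
      zero_add] at h
    exact h
  have main : ∀ (n : ℕ) (p : Polynomial (Polynomial ℂ)), (∀ z, p.evalEval (f z) (g z) = 0) →
      p.coeff n = 0 := by
    intro n
    induction n with
    | zero => exact key
    | succ n ih =>
      intro p hp
      rw [← coeff_divX]
      refine ih _ fun z ↦ ?_
      have hmul : ∀ z ∈ Set.univ, g z * p.divX.evalEval (f z) (g z) = 0 := by
        intro z _
        have h := hp z
        rw [← p.divX_mul_X_add, evalEval_add, evalEval_mul, evalEval_X, evalEval_C, key p hp,
          eval_zero, add_zero] at h
        rw [mul_comm, h]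
      rcases AnalyticOnNhd.eq_zero_or_eq_zero_of_mul_eq_zero
        (hg.differentiableOn.analyticOnNhd isOpen_univ)
        ((differentiable_evalEval hf hg p.divX).differentiableOn.analyticOnNhd isOpen_univ)
        hmul isPreconnected_univ with h | h
      · obtain ⟨z₀, hz₀⟩ := hg0
        exact absurd (h z₀ trivial) hz₀
      · exact h z trivial
  ext1 n
  exact main n p hp

end BivariatePolynomials

section EisensteinSeries

open UpperHalfPlane ModularForm ModularGroup Filter Topology
open scoped MatrixGroups

lemma tendsto_E₄_atImInfty : Tendsto E₄ atImInfty (𝓝 1) := by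
  have hanal := ModularFormClass.analyticAt_cuspFunction_zero E₄ one_pos one_mem_strictPeriods_SL
  have h0 : cuspFunction 1 E₄ 0 = 1 := by
    rw [← EisensteinSeries.E_qExpansion_coeff_zero (k := 4) (by norm_num) ⟨2, rfl⟩,
      qExpansion_coeff_zero one_pos hanal
        (SlashInvariantFormClass.periodic_comp_ofComplex E₄ one_mem_strictPeriods_SL)]
    exact cuspFunction_apply_zero one_pos hanal
      (SlashInvariantFormClass.periodic_comp_ofComplex E₄ one_mem_strictPeriods_SL)
  rw [← h0]
  exact (hanal.continuousAt.tendsto.comp (qParam_tendsto_atImInfty one_pos)).congr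
    fun τ ↦ SlashInvariantFormClass.eq_cuspFunction E₄ τ one_mem_strictPeriods_SL one_ne_zero

lemma polynomial_eq_zero_of_eval_add_natCast {p : Polynomial ℂ} {a : ℂ}
    (h : ∀ n : ℕ, p.eval (a + n) = 0) : p = 0 := by
  refine Polynomial.eq_zero_of_infinite_isRoot _
    ((Set.infinite_range_of_injective (f := fun n : ℕ ↦ a + n) fun m n h ↦ ?_).mono ?_)
  · simpa using h
  · rintro _ ⟨n, rfl⟩
    exact h n

lemma eval_weighted_E₄_E₆ {Q : MvPolynomial (Fin 2) ℂ}
    (hQ : ∀ τ : ℍ, MvPolynomial.eval ![E₄ τ, E₆ τ] Q = 0) (τ : ℍ) (t : ℂ) :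
    MvPolynomial.eval ![t ^ 4 * E₄ τ, t ^ 6 * E₆ τ] Q = 0 := by
  let p : Polynomial ℂ := MvPolynomial.aeval
    ![Polynomial.X ^ 4 * Polynomial.C (E₄ τ), Polynomial.X ^ 6 * Polynomial.C (E₆ τ)] Q
  have hp (s : ℂ) : p.eval s = MvPolynomial.eval ![s ^ 4 * E₄ τ, s ^ 6 * E₆ τ] Q := by
    rw [← Polynomial.coe_aeval_eq_eval, algHom_aeval_eq_eval]
    congr 2
    ext i
    fin_cases i <;> simp <;> ring
  have hp0 : p = 0 := by
    refine polynomial_eq_zero_of_eval_add_natCast (a := τ) fun n ↦ ?_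
    rw [hp]
    have hS (k : ℕ) (f : ModularForm 𝒮ℒ k) :
        f (Matrix.SpecialLinearGroup.mapGL ℝ S • ((n : ℝ) +ᵥ τ)) =
          ((τ : ℂ) + n) ^ k * f τ := by
      have h1 := SlashInvariantForm.slash_action_eqn'' (Γ := 𝒮ℒ) f
        (MonoidHom.mem_range.mpr ⟨S, rfl⟩) ((n : ℝ) +ᵥ τ)
      have h2 := SlashInvariantForm.vAdd_apply_of_mem_strictPeriods f τ
        (h := n) (by simpa [AddSubgroup.mem_zmultiples_iff] using ⟨(n : ℤ), by simp⟩)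
      erw [denom_S] at h1
      rw [h2] at h1
      simpa [add_comm] using h1
    have h := hQ (Matrix.SpecialLinearGroup.mapGL ℝ S • ((n : ℝ) +ᵥ τ))
    rwa [hS 4 E₄, hS 6 E₆] at h
  rw [← hp, hp0, Polynomial.eval_zero]

lemma infinite_range_E₆_sq_div_E₄_cube :
    {r : ℂ | ∃ τ : ℍ, E₄ τ ≠ 0 ∧ r = E₆ τ ^ 2 / E₄ τ ^ 3}.Infinite := by
  intro hfin
  have hlim : Tendsto (fun τ ↦ E₆ τ ^ 2 / E₄ τ ^ 3) atImInfty (𝓝 1) := by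
    have h1 : Tendsto (fun τ ↦ (E₄ τ ^ 3 - 1728 * ModularForm.discriminant τ) / E₄ τ ^ 3) atImInfty
        (𝓝 ((1 ^ 3 - 1728 * 0) / 1 ^ 3)) :=
      ((tendsto_E₄_atImInfty.pow 3).sub
        (discriminant_isZeroAtImInfty.const_mul 1728)).div (tendsto_E₄_atImInfty.pow 3) (by simp)
    refine (h1.congr fun τ ↦ ?_).trans_eq (by simp)
    rw [discriminant_eq_E₄_cube_sub_E₆_sq]
    ring
  have hne : ∀ᶠ τ in atImInfty, E₄ τ ≠ 0 := tendsto_E₄_atImInfty.eventually_ne one_ne_zero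
  have hnhds : ({r : ℂ | ∃ τ : ℍ, E₄ τ ≠ 0 ∧ r = E₆ τ ^ 2 / E₄ τ ^ 3} \ {1})ᶜ ∈ 𝓝 (1 : ℂ) :=
    (hfin.sdiff).isClosed.isOpen_compl.mem_nhds (by simp)
  obtain ⟨τ, hτ, hτ'⟩ := (hne.and (hlim.eventually_mem hnhds)).exists
  refine hτ' ⟨⟨τ, hτ, rfl⟩, fun h ↦ ?_⟩
  have h1 : E₆ τ ^ 2 / E₄ τ ^ 3 = 1 := h
  rw [div_eq_one_iff_eq (pow_ne_zero 3 hτ)] at h1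
  refine discriminant_ne_zero τ ?_
  have := discriminant_eq_E₄_cube_sub_E₆_sq τ
  rw [h1] at this
  simpa using this

/-- The modular forms `E₄` and `E₆` are algebraically independent. -/
lemma eq_zero_of_eval_E₄_E₆ {Q : MvPolynomial (Fin 2) ℂ}
    (hQ : ∀ τ : ℍ, MvPolynomial.eval ![E₄ τ, E₆ τ] Q = 0) : Q = 0 := by
  let A : Set ℂ := {c | ∀ t : ℂ, MvPolynomial.eval ![t ^ 4, t ^ 6 * c] Q = 0}
  have hA : A.Infinite := by
    refine Set.Infinite.of_image (· ^ 2) (infinite_range_E₆_sq_div_E₄_cube.mono ?_)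
    rintro _ ⟨τ, hτ, rfl⟩
    obtain ⟨w, hw⟩ := IsAlgClosed.exists_pow_nat_eq (E₄ τ)⁻¹ (n := 4) (by norm_num)
    refine ⟨w ^ 6 * E₆ τ, fun t ↦ ?_, ?_⟩
    · have h := eval_weighted_E₄_E₆ hQ τ (t * w)
      rwa [mul_pow, mul_pow, hw, mul_assoc, inv_mul_cancel₀ hτ, mul_one, mul_assoc] at h
    · change (w ^ 6 * E₆ τ) ^ 2 = _
      rw [show (w ^ 6 * E₆ τ) ^ 2 = (w ^ 4) ^ 3 * E₆ τ ^ 2 by ring, hw]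
      field_simp
  have hall (t c : ℂ) : MvPolynomial.eval ![t ^ 4, t ^ 6 * c] Q = 0 := by
    let p : Polynomial ℂ := MvPolynomial.aeval
      ![Polynomial.C (t ^ 4), Polynomial.C (t ^ 6) * Polynomial.X] Q
    have hp (s : ℂ) : p.eval s = MvPolynomial.eval ![t ^ 4, t ^ 6 * s] Q := by
      rw [← Polynomial.coe_aeval_eq_eval, algHom_aeval_eq_eval]
      congr 2
      ext i
      fin_cases i <;> simp
    have hp0 : p = 0 := Polynomial.eq_zero_of_infinite_isRoot _
      (hA.mono fun s hs ↦ (hp s).trans ((show s ∈ A from hs) t))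
    rw [← hp, hp0, Polynomial.eval_zero]
  have hmul : Q * MvPolynomial.X 0 = 0 := by
    refine MvPolynomial.funext fun v ↦ ?_
    rw [map_mul, MvPolynomial.eval_X, map_zero]
    rcases eq_or_ne (v 0) 0 with h0 | h0
    · rw [h0, mul_zero]
    obtain ⟨t, ht⟩ := IsAlgClosed.exists_pow_nat_eq (v 0) (n := 4) (by norm_num)
    have ht0 : t ≠ 0 := by
      rintro rfl
      exact h0 (by simpa using ht.symm)
    have h := hall t (v 1 / t ^ 6)
    rw [mul_div_cancel₀ _ (pow_ne_zero 6 ht0), ht] at h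
    rw [show v = ![v 0, v 1] by ext i; fin_cases i <;> rfl, h, zero_mul]
  exact (mul_eq_zero.mp hmul).resolve_right (MvPolynomial.X_ne_zero 0)

end EisensteinSeries

section EisensteinDifferentiability

open UpperHalfPlane ModularForm Filter Topology
open scoped MatrixGroups

lemma Eis_coe_eq {k : ℕ} (hk : 3 ≤ k) (hk2 : Even k) (τ : ℍ) : Eis k τ = E hk τ := by
  rw [EisensteinSeries.q_expansion_bernoulli hk hk2, Eis,
    tsum_pnat_eq_tsum_succ (f := fun n : ℕ ↦
      (ArithmeticFunction.sigma (k - 1) n : ℂ) *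
        Complex.exp (2 * Real.pi * Complex.I * τ) ^ (n : ℤ))]
  simp [sigma', ArithmeticFunction.sigma_apply, qC, e2, ← zpow_natCast]

lemma differentiableOn_Eis {k : ℕ} (hk : 3 ≤ k) (hk2 : Even k) :
    DifferentiableOn ℂ (Eis k) {τ | 0 < τ.im} := by
  refine (UpperHalfPlane.mdifferentiable_iff.mp (ModularFormClass.holo (E hk))).congr fun τ hτ ↦ ?_
  rw [Function.comp_apply, ofComplex_apply_of_im_pos hτ, ← Eis_coe_eq hk hk2]

lemma differentiableOn_eval {σ : Type*} [Fintype σ] {U : Set ℂ} {F : σ → ℂ → ℂ}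
    (hF : ∀ i, DifferentiableOn ℂ (F i) U) (P : MvPolynomial σ ℂ) :
    DifferentiableOn ℂ (fun τ ↦ MvPolynomial.eval (fun i ↦ F i τ) P) U := by
  induction P using MvPolynomial.induction_on with
  | C a => simp
  | add p q hp hq =>
    simp only [map_add]
    exact hp.add hq
  | mul_X p i hp =>
    simp only [map_mul, MvPolynomial.eval_X]
    exact hp.mul (hF i)

/-- A polynomial in `E₄` and `E₆` vanishing for large imaginary part vanishes on `ℍ`. -/
lemma eval_Eis_eq_zero_of_one_le_im {P : MvPolynomial (Fin 4) ℂ} {x y : ℂ}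
    (h : ∀ τ : ℂ, 1 ≤ τ.im → MvPolynomial.eval ![Eis 4 τ, Eis 6 τ, x, y] P = 0) {τ : ℂ}
    (hτ : 0 < τ.im) : MvPolynomial.eval ![Eis 4 τ, Eis 6 τ, x, y] P = 0 := by
  have hU : IsOpen {τ : ℂ | 0 < τ.im} := isOpen_lt continuous_const Complex.continuous_im
  have hd : DifferentiableOn ℂ
      (fun τ ↦ MvPolynomial.eval ![Eis 4 τ, Eis 6 τ, x, y] P) {τ | 0 < τ.im} := by
    convert differentiableOn_eval (F := ![Eis 4, Eis 6, fun _ ↦ x, fun _ ↦ y]) ?_ P using 4 with τ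
    · ext i
      fin_cases i <;> rfl
    · intro i
      fin_cases i
      · exact differentiableOn_Eis (by norm_num) ⟨2, rfl⟩
      · exact differentiableOn_Eis (by norm_num) ⟨3, rfl⟩
      · exact differentiableOn_const x
      · exact differentiableOn_const y
  refine (hd.analyticOnNhd hU).eqOn_zero_of_preconnected_of_eventuallyEq_zero
    (convex_halfSpace_im_gt 0).isPreconnected (z₀ := 2 * Complex.I) (by simp) ?_ hτ
  filter_upwards [(isOpen_lt continuous_const Complex.continuous_im).mem_nhds
    (show (1 : ℝ) < (2 * Complex.I).im by simp)] with τ hτ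
  exact h τ (le_of_lt hτ)

end EisensteinDifferentiability

section ThetaProduct

/-- The `q`-Pochhammer product `∏_{n ≥ 1} (1 - qⁿ w)`. -/
def qProd (q w : ℂ) : ℂ := ∏' n : ℕ, (1 - q ^ (n + 1) * w)

lemma summable_norm_qProd {q : ℂ} (hq : ‖q‖ < 1) (w : ℂ) :
    Summable fun n : ℕ ↦ ‖-(q ^ (n + 1) * w)‖ := by
  simpa using ((summable_nat_add_iff 1).mpr
    (summable_geometric_of_lt_one (norm_nonneg q) hq)).mul_right ‖w‖

lemma multipliable_qProd {q : ℂ} (hq : ‖q‖ < 1) (w : ℂ) :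
    Multipliable fun n : ℕ ↦ 1 - q ^ (n + 1) * w := by
  simpa [sub_eq_add_neg] using multipliable_one_add_of_summable (summable_norm_qProd hq w)

lemma qProd_eq_zero {q w : ℂ} {n : ℕ} (h : q ^ (n + 1) * w = 1) : qProd q w = 0 :=
  tprod_of_exists_eq_zero ⟨n, by rw [h, sub_self]⟩

lemma qProd_ne_zero {q w : ℂ} (hq : ‖q‖ < 1) (hw : ‖w‖ ≤ 1) : qProd q w ≠ 0 := by
  have h := tprod_one_add_ne_zero_of_summable (f := fun n : ℕ ↦ -(q ^ (n + 1) * w))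
    (fun n h ↦ ?_) (summable_norm_qProd hq w)
  · simpa [qProd, sub_eq_add_neg] using h
  · have h1 : q ^ (n + 1) * w = 1 := by linear_combination -h
    have h2 : ‖q‖ ^ (n + 1) * ‖w‖ = 1 := by rw [← norm_pow, ← norm_mul, h1, norm_one]
    have h3 : ‖q‖ ^ (n + 1) < 1 := pow_lt_one₀ (norm_nonneg _) hq n.succ_ne_zero
    nlinarith [norm_nonneg w, pow_nonneg (norm_nonneg q) (n + 1)]

lemma differentiable_qProd {q : ℂ} (hq : ‖q‖ < 1) : Differentiable ℂ (qProd q) := by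
  intro w₀
  have hsum : Summable fun n : ℕ ↦ ‖q‖ ^ (n + 1) * (‖w₀‖ + 1) :=
    ((summable_nat_add_iff 1).mpr (summable_geometric_of_lt_one (norm_nonneg q) hq)).mul_right _
  have hprod := hsum.hasProdLocallyUniformlyOn_nat_one_add (K := Metric.ball (0 : ℂ) (‖w₀‖ + 1))
    (f := fun n w ↦ -(q ^ (n + 1) * w)) Metric.isOpen_ball
    (.of_forall fun n w hw ↦ ?_) (fun n ↦ by fun_prop)
  · have hd := hprod.differentiableOn (.of_forall fun _ ↦ by
      simpa [Finset.prod_fn] using DifferentiableOn.finsetProd (fun _ _ ↦ by fun_prop))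
      Metric.isOpen_ball
    refine (hd.congr fun w _ ↦ ?_).differentiableAt
      (Metric.isOpen_ball.mem_nhds (by simp))
    simp [qProd, sub_eq_add_neg]
  · rw [norm_neg, norm_mul, norm_pow]
    have : ‖w‖ < ‖w₀‖ + 1 := by simpa using hw
    gcongr

lemma norm_qC_lt_one {τ : ℂ} (hτ : 0 < τ.im) : ‖qC τ‖ < 1 := by
  rw [qC, e2, Complex.norm_exp, Real.exp_lt_one_iff]
  have := mul_pos Real.pi_pos hτ
  simp
  linarith

lemma theta_eq_qProd {τ : ℂ} (hτ : 0 < τ.im) (z : ℂ) :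
    theta τ z = Complex.exp (Real.pi * I * τ / 4) *
      (Complex.exp (Real.pi * I * z) - Complex.exp (-(Real.pi * I * z))) *
      (qProd (qC τ) (zetaC z) * qProd (qC τ) (zetaC z)⁻¹ * qProd (qC τ) 1) := by
  have hq := norm_qC_lt_one hτ
  rw [theta, qProd, qProd, qProd, ← (multipliable_qProd hq _).tprod_mul (multipliable_qProd hq _),
    ← ((multipliable_qProd hq _).mul (multipliable_qProd hq _)).tprod_mul
      (multipliable_qProd hq _)]
  simp only [mul_one]

lemma differentiable_theta {τ : ℂ} (hτ : 0 < τ.im) : Differentiable ℂ (theta τ) := by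
  have hP := differentiable_qProd (norm_qC_lt_one hτ)
  have h1 : Differentiable ℂ fun z ↦ qProd (qC τ) (zetaC z) :=
    hP.comp (by unfold zetaC e2; fun_prop)
  have h2 : Differentiable ℂ fun z ↦ qProd (qC τ) (zetaC z)⁻¹ :=
    hP.comp (by simp only [zetaC, e2, ← Complex.exp_neg]; fun_prop)
  rw [show theta τ = _ from funext (theta_eq_qProd hτ)]
  fun_prop

lemma eta_ne_zero {τ : ℂ} (hτ : 0 < τ.im) : eta τ ≠ 0 := by
  have h := qProd_ne_zero (w := 1) (norm_qC_lt_one hτ) (by simp)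
  simp only [qProd, mul_one] at h
  exact mul_ne_zero (Complex.exp_ne_zero _) h

lemma differentiable_phiM21 {τ : ℂ} (hτ : 0 < τ.im) : Differentiable ℂ (phiM21 τ) :=
  ((differentiable_theta hτ).pow 2).div_const _

lemma phiM21_succ_mul {τ : ℂ} (hτ : 0 < τ.im) (m : ℕ) : phiM21 τ ((m + 1) * τ) = 0 := by
  have h : qProd (qC τ) (zetaC ((m + 1) * τ))⁻¹ = 0 := by
    refine qProd_eq_zero (n := m) ?_
    rw [qC, zetaC, e2, e2, ← Complex.exp_nat_mul, ← Complex.exp_neg, ← Complex.exp_add,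
      Complex.exp_eq_one_iff]
    exact ⟨0, by push_cast; ring⟩
  simp [phiM21, theta_eq_qProd hτ, h]

lemma phiM21_half_ne_zero {τ : ℂ} (hτ : 0 < τ.im) : phiM21 τ (1 / 2) ≠ 0 := by
  have hq := norm_qC_lt_one hτ
  have hζ : zetaC (1 / 2) = -1 := by
    rw [zetaC, e2, ← Complex.exp_pi_mul_I]
    congr 1
    ring
  have hI : Complex.exp (Real.pi * I * (1 / 2)) = I := by
    rw [show (Real.pi : ℂ) * I * (1 / 2) = Real.pi / 2 * I by ring, Complex.exp_pi_div_two_mul_I]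
  refine div_ne_zero (pow_ne_zero 2 ?_) (pow_ne_zero 6 (eta_ne_zero hτ))
  rw [theta_eq_qProd hτ, hζ, Complex.exp_neg, hI]
  refine mul_ne_zero (mul_ne_zero (Complex.exp_ne_zero _) ?_) (mul_ne_zero (mul_ne_zero ?_ ?_) ?_)
  · rw [Complex.inv_I, sub_neg_eq_add, ← two_mul]
    exact mul_ne_zero two_ne_zero I_ne_zero
  all_goals exact qProd_ne_zero hq (by simp)

end ThetaProduct

section ThetaSeries

lemma theta00_eq (τ z : ℂ) : theta00 τ z = jacobiTheta₂ z τ := by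
  refine tsum_congr fun n ↦ ?_
  rw [jacobiTheta₂_term]
  congr 1
  ring

lemma theta01_eq (τ z : ℂ) : theta01 τ z = jacobiTheta₂ (z + 1 / 2) τ := by
  refine tsum_congr fun n ↦ ?_
  rw [jacobiTheta₂_term, ← Complex.exp_pi_mul_I, ← Complex.exp_int_mul, ← Complex.exp_add]
  congr 1
  ring

lemma theta10_eq (τ z : ℂ) : theta10 τ z =
    Complex.exp (Real.pi * I * τ / 4) * Complex.exp (Real.pi * I * z) *
      jacobiTheta₂ (z + τ / 2) τ := by
  rw [theta10, jacobiTheta₂]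
  congr 1
  refine tsum_congr fun n ↦ ?_
  rw [jacobiTheta₂_term]
  congr 1
  ring

lemma theta00_add_period (τ z : ℂ) :
    theta00 τ (z + τ) = Complex.exp (-Real.pi * I * (τ + 2 * z)) * theta00 τ z := by
  rw [theta00_eq, theta00_eq, jacobiTheta₂_add_left']

lemma theta01_add_period (τ z : ℂ) :
    theta01 τ (z + τ) = -(Complex.exp (-Real.pi * I * (τ + 2 * z)) * theta01 τ z) := by
  rw [theta01_eq, theta01_eq, show z + τ + 1 / 2 = z + 1 / 2 + τ by ring, jacobiTheta₂_add_left',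
    show -Real.pi * I * (τ + 2 * (z + 1 / 2)) = -Real.pi * I * (τ + 2 * z) - Real.pi * I by ring,
    Complex.exp_sub, Complex.exp_pi_mul_I]
  ring

lemma theta10_add_period (τ z : ℂ) :
    theta10 τ (z + τ) = Complex.exp (-Real.pi * I * (τ + 2 * z)) * theta10 τ z := by
  rw [theta10_eq, theta10_eq, show z + τ + τ / 2 = z + τ / 2 + τ by ring, jacobiTheta₂_add_left',
    mul_add (Real.pi * I : ℂ) z τ, Complex.exp_add,
    show -Real.pi * I * (τ + 2 * (z + τ / 2)) = -Real.pi * I * (τ + 2 * z) - Real.pi * I * τ by ring,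
    Complex.exp_sub]
  field_simp

lemma phi01_add_period (τ z : ℂ) :
    phi01 τ (z + τ) = Complex.exp (-(2 * Real.pi * I * (τ + 2 * z))) * phi01 τ z := by
  have h : Complex.exp (-(2 * Real.pi * I * (τ + 2 * z))) =
      Complex.exp (-Real.pi * I * (τ + 2 * z)) ^ 2 := by
    rw [← Complex.exp_nat_mul]
    congr 1
    push_cast
    ring
  rw [h, phi01, phi01, xi00, xi01, xi10, theta00_add_period, theta01_add_period,
    theta10_add_period, xi00, xi01, xi10]
  ring

lemma phi01_natCast_mul (τ : ℂ) (m : ℕ) :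
    phi01 τ (m * τ) = Complex.exp (-(2 * Real.pi * I * (m ^ 2 * τ))) * phi01 τ 0 := by
  induction m with
  | zero => simp
  | succ m ih =>
    rw [show ((m + 1 : ℕ) : ℂ) * τ = m * τ + τ by push_cast; ring, phi01_add_period, ih,
      ← mul_assoc, ← Complex.exp_add]
    congr 2
    push_cast
    ring

lemma theta00_zero_ne_zero {τ : ℂ} (hτ : 1 ≤ τ.im) : theta00 τ 0 ≠ 0 := by
  intro h
  have hb := norm_jacobiTheta_sub_one_le (τ := τ) (by linarith)
  rw [theta00_eq, ← jacobiTheta_eq_jacobiTheta₂] at h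
  rw [h, zero_sub, norm_neg, norm_one] at hb
  have he : Real.exp (-Real.pi * τ.im) ≤ 1 / 4 := by
    have h1 : 1 + 3 ≤ Real.exp (Real.pi * τ.im) := by
      have := Real.add_one_le_exp (Real.pi * τ.im)
      nlinarith [Real.pi_gt_three]
    rw [neg_mul, Real.exp_neg, one_div]
    exact inv_anti₀ (by norm_num) (by linarith)
  rw [div_mul_eq_mul_div, le_div_iff₀ (by linarith)] at hb
  linarith

lemma phi01_zero_ne_zero {τ : ℂ} (hτ : 1 ≤ τ.im) : phi01 τ 0 ≠ 0 := by
  rw [phi01, xi00, xi01, xi10, div_self (theta00_zero_ne_zero hτ)]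
  rcases eq_or_ne (theta01 τ 0) 0 with h1 | h1 <;> rcases eq_or_ne (theta10 τ 0) 0 with h2 | h2 <;>
    norm_num [h1, h2]

lemma differentiable_phi01 {τ : ℂ} (hτ : 0 < τ.im) : Differentiable ℂ (phi01 τ) := by
  have hJ : Differentiable ℂ fun z ↦ jacobiTheta₂ z τ :=
    fun z ↦ differentiableAt_jacobiTheta₂_fst z hτ
  have h00 : Differentiable ℂ (theta00 τ) := by
    rwa [show theta00 τ = _ from funext (theta00_eq τ)]
  have h01 : Differentiable ℂ (theta01 τ) := by
    rw [show theta01 τ = _ from funext (theta01_eq τ)]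
    exact hJ.comp (differentiable_id.add_const _)
  have h10 : Differentiable ℂ (theta10 τ) := by
    rw [show theta10 τ = _ from funext (theta10_eq τ)]
    have := hJ.comp (differentiable_id.add_const (τ / 2))
    exact Differentiable.mul (by fun_prop) this
  exact ((((h00.div_const _).pow 2).add ((h01.div_const _).pow 2)).add
    ((h10.div_const _).pow 2)).const_mul 4

lemma injective_phi01_natCast_mul {τ : ℂ} (hτ : 1 ≤ τ.im) :
    Function.Injective fun m : ℕ ↦ phi01 τ ((m + 1) * τ) := by
  have hpos : 0 < 2 * Real.pi * τ.im := by have := Real.pi_pos; positivity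
  intro m n h
  have h1 : ‖phi01 τ ((m + 1) * τ)‖ = ‖phi01 τ ((n + 1) * τ)‖ := congrArg norm h
  have hn (m : ℕ) : ‖phi01 τ ((m + 1) * τ)‖ =
      Real.exp (2 * Real.pi * τ.im * (m + 1) ^ 2) * ‖phi01 τ 0‖ := by
    have := phi01_natCast_mul τ (m + 1)
    rw [Nat.cast_succ] at this
    rw [this, norm_mul, Complex.norm_exp]
    congr 2
    rw [show -(2 * (Real.pi : ℂ) * I * ((m + 1) ^ 2 * τ)) =
      ((-(2 * Real.pi * (m + 1) ^ 2) : ℝ) : ℂ) * (I * τ) by push_cast; ring, Complex.re_ofReal_mul]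
    simp
    ring
  rw [hn, hn, mul_left_inj' (norm_ne_zero_iff.mpr (phi01_zero_ne_zero hτ)), Real.exp_eq_exp,
    mul_right_inj' hpos.ne'] at h1
  have h2 : (m + 1) ^ 2 = (n + 1) ^ 2 := by exact_mod_cast h1
  simpa using h2

end ThetaSeries

/-- For fixed `τ` of large imaginary part, `φ_{0,1}(τ,·)` and `φ_{-2,1}(τ,·)` are algebraically
independent. -/
lemma eval_eq_zero_of_one_le_im {P : MvPolynomial (Fin 4) ℂ} {τ a b : ℂ} (hτ : 1 ≤ τ.im)
    (h : ∀ z, MvPolynomial.eval ![a, b, phi01 τ z, phiM21 τ z] P = 0) (x y : ℂ) :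
    MvPolynomial.eval ![a, b, x, y] P = 0 := by
  have hτ0 : 0 < τ.im := by linarith
  let p : Polynomial (Polynomial ℂ) := MvPolynomial.aeval
    ![Polynomial.CC a, Polynomial.CC b, Polynomial.C Polynomial.X, Polynomial.X] P
  have hp (s t : ℂ) : p.evalEval s t = MvPolynomial.eval ![a, b, s, t] P := by
    rw [← Polynomial.coe_aevalAeval_eq_evalEval, algHom_aeval_eq_eval]
    congr 2
    ext i
    fin_cases i <;> simp
  have hp0 : p = 0 := eq_zero_of_evalEval_eq_zero (differentiable_phi01 hτ0)
    (differentiable_phiM21 hτ0) ⟨1 / 2, phiM21_half_ne_zero hτ0⟩ (phiM21_succ_mul hτ0)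
    (injective_phi01_natCast_mul hτ) fun z ↦ (hp _ _).trans (h z)
  rw [← hp, hp0, Polynomial.evalEval_zero]

/-- the four functions `E₄(τ), E₆(τ), φ_{0,1}(τ,z), φ_{-2,1}(τ,z)` on `ℍ × ℂ`
are algebraically independent over `ℂ`. -/
theorem algebraically_independent_E4_E6_phi01_phiM21 (P : MvPolynomial (Fin 4) ℂ)
    (h : ∀ τ z : ℂ, 0 < τ.im →
      MvPolynomial.eval (![Eis 4 τ, Eis 6 τ, phi01 τ z, phiM21 τ z]) P = 0) :
    P = 0 := by
  have hEis (x y τ : ℂ) (hτ : 0 < τ.im) :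
      MvPolynomial.eval ![Eis 4 τ, Eis 6 τ, x, y] P = 0 :=
    eval_Eis_eq_zero_of_one_le_im (fun τ hτ ↦ eval_eq_zero_of_one_le_im hτ
      (fun z ↦ h τ z (by linarith)) x y) hτ
  refine MvPolynomial.funext fun v ↦ ?_
  let Q : MvPolynomial (Fin 2) ℂ := MvPolynomial.aeval
    ![MvPolynomial.X 0, MvPolynomial.X 1, MvPolynomial.C (v 2), MvPolynomial.C (v 3)] P
  have hQ (a b : ℂ) : MvPolynomial.eval ![a, b] Q = MvPolynomial.eval ![a, b, v 2, v 3] P := by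
    rw [← MvPolynomial.aeval_eq_eval, algHom_aeval_eq_eval]
    congr 2
    ext i
    fin_cases i <;> simp
  have hQ0 : Q = 0 := eq_zero_of_eval_E₄_E₆ fun τ ↦ by
    rw [hQ, ← Eis_coe_eq _ ⟨2, rfl⟩, ← Eis_coe_eq _ ⟨3, rfl⟩]
    exact hEis _ _ τ τ.im_pos
  rw [map_zero, ← map_zero (MvPolynomial.eval ![v 0, v 1]), ← hQ0, hQ]
  congr 2
  ext i
  fin_cases i <;> rfl


end JacobiPaper
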